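/- Let X be a geodesic metric space. Assume that for some θ > 0 and ν ≥ 8 the set of (θ,ν)-fat geodesic hexagons in X is either empty or consists of hexagons of uniformly bounded diameter. Then X is Gromov hyperbolic. -/

import Mathlib

open Set Metric

/-! ### Basic metric notions: tubular neighborhoods, geodesics -/

variable {X : Type*} [MetricSpace X]

/-- Open `δ`-tubular neighborhood of a subset. -/
def tubN (δ : ℝ) (A : Set X) : Set X := {x | Metric.infDist x A < δ}

/-- Closed `δ`-tubular neighborhood of a subset. -/
def ctubN (δ : ℝ) (A : Set X) : Set X := {x | Metric.infDist x A ≤ δ}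

/-- `γ` parametrizes a geodesic of length `ℓ` (an isometric embedding of `[0,ℓ]`). -/
def IsGeodesicParam (γ : ℝ → X) (ℓ : ℝ) : Prop :=
  0 ≤ ℓ ∧ ∀ s ∈ Set.Icc (0:ℝ) ℓ, ∀ t ∈ Set.Icc (0:ℝ) ℓ, dist (γ s) (γ t) = |s - t|

/-- A metric space is geodesic if every two points are joined by a geodesic. -/
def GeodesicSpace (X : Type*) [MetricSpace X] : Prop :=
  ∀ x y : X, ∃ (γ : ℝ → X) (ℓ : ℝ), IsGeodesicParam γ ℓ ∧ γ 0 = x ∧ γ ℓ = y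

/-- The cyclic successor of an index in `Fin k`. -/
def finCycSucc {k : ℕ} (i : Fin k) : Fin k := ⟨(i.val + 1) % k, Nat.mod_lt _ i.pos⟩

/-! ### Polygons -/

/-- The data of a `k`-gon: `k` parametrized paths with their lengths. -/
structure PrePolygon (X : Type*) (k : ℕ) where
  edge : Fin k → ℝ → X
  len : Fin k → ℝ

namespace PrePolygon

variable {k : ℕ}

/-- The `i`-th edge, as a subset. -/
def edgeSet (P : PrePolygon X k) (i : Fin k) : Set X := P.edge i '' Set.Icc 0 (P.len i)

/-- The polygon, as a subset (union of its edges). -/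
def carrier (P : PrePolygon X k) : Set X := ⋃ i, P.edgeSet i

/-- The `i`-th vertex (the origin of the `i`-th edge). -/
def vertex (P : PrePolygon X k) (i : Fin k) : X := P.edge i 0

/-- The union `O_x` of the edges not adjacent to the `i`-th vertex. -/
def opp (P : PrePolygon X k) (i : Fin k) : Set X :=
  ⋃ j ∈ {j : Fin k | j ≠ i ∧ finCycSucc j ≠ i}, P.edgeSet j

/-- The edges close up cyclically (the endpoint of each edge is the origin of the next). -/
def IsClosedPolygon (P : PrePolygon X k) : Prop :=
  (∀ i, 0 ≤ P.len i) ∧ ∀ i, P.edge i (P.len i) = P.edge (finCycSucc i) 0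

/-- A geodesic `k`-gon. -/
def IsGeodesicPolygon (P : PrePolygon X k) : Prop :=
  P.IsClosedPolygon ∧ ∀ i, IsGeodesicParam (P.edge i) (P.len i)

/-- The polygon is `(θ,σ,ν)`-fat:  (F1) every point of an edge at distance at least `σθ`
from both endpoints of the edge is at distance at least `θ` from the rest of the polygon;
(F2) every vertex is at distance at least `νθ` from the union of the non-adjacent edges. -/
def IsFat (P : PrePolygon X k) (θ σ ν : ℝ) : Prop :=
  (∀ i : Fin k, ∀ p ∈ P.edgeSet i,
      σ * θ ≤ dist p (P.edge i 0) → σ * θ ≤ dist p (P.edge i (P.len i)) →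
      θ ≤ Metric.infDist p (P.carrier \ P.edgeSet i)) ∧
  (∀ i : Fin k, ν * θ ≤ Metric.infDist (P.vertex i) (P.opp i))

/-- `(θ,ν)`-fat means `(θ,2,ν)`-fat. -/
def IsFat2 (P : PrePolygon X k) (θ ν : ℝ) : Prop := P.IsFat θ 2 ν

end PrePolygon

/-! ### Gromov hyperbolicity (thin triangles) -/

/-- A geodesic metric space is Gromov hyperbolic if there is `δ ≥ 0` such that every geodesic
triangle is `δ`-thin: each side lies in the closed `δ`-neighborhood of the other two sides. -/
def GromovHyperbolic (X : Type*) [MetricSpace X] : Prop :=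
  ∃ δ : ℝ, 0 ≤ δ ∧ ∀ T : PrePolygon X 3, T.IsGeodesicPolygon →
    ∀ i : Fin 3, ∀ p ∈ T.edgeSet i,
      Metric.infDist p (T.edgeSet (finCycSucc i) ∪ T.edgeSet (finCycSucc (finCycSucc i))) ≤ δ

/-! ### The Druţu–Sapir properties of a pair `(X, 𝓐)` -/

/-- Property (α₁): uniformly bounded intersections of tubular neighborhoods. -/
def Alpha1 (𝓐 : Set (Set X)) : Prop :=
  ∀ δ : ℝ, 0 < δ → ∃ D : ℝ, ∀ A ∈ 𝓐, ∀ A' ∈ 𝓐, A ≠ A' →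
    ∀ x ∈ tubN δ A ∩ tubN δ A', ∀ y ∈ tubN δ A ∩ tubN δ A', dist x y ≤ D

/-- Property (α₂) with given constants `ε`, `M`. -/
def Alpha2With (𝓐 : Set (Set X)) (ε M : ℝ) : Prop :=
  ∀ (γ : ℝ → X) (ℓ : ℝ), IsGeodesicParam γ ℓ → ∀ A ∈ 𝓐,
    γ 0 ∈ tubN (ε * ℓ) A → γ ℓ ∈ tubN (ε * ℓ) A →
    ∃ t ∈ Set.Icc (0:ℝ) ℓ, γ t ∈ tubN M A

/-- Property (α₂). -/
def Alpha2 (𝓐 : Set (Set X)) : Prop :=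
  ∃ ε M : ℝ, 0 ≤ ε ∧ ε < 1/2 ∧ 0 < M ∧ Alpha2With 𝓐 ε M

/-- Property (α₃): fat geodesic `k`-gons lie in tubular neighborhoods of pieces. -/
def Alpha3 (𝓐 : Set (Set X)) : Prop :=
  ∀ k : ℕ, 2 ≤ k → ∃ θ : ℝ, 0 < θ ∧ ∃ ν : ℝ, 8 ≤ ν ∧ ∃ χ : ℝ, 0 < χ ∧
    ∀ P : PrePolygon X k, P.IsGeodesicPolygon → P.IsFat2 θ ν →
      ∃ A ∈ 𝓐, P.carrier ⊆ tubN χ A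

/-- Property (β₂) with given constants `ε`, `M`: middle thirds of geodesics with endpoints
close to a piece stay close to the piece. -/
def Beta2With (𝓐 : Set (Set X)) (ε M : ℝ) : Prop :=
  ∀ (γ : ℝ → X) (ℓ : ℝ), IsGeodesicParam γ ℓ → ∀ A ∈ 𝓐,
    γ 0 ∈ tubN (ε * ℓ) A → γ ℓ ∈ tubN (ε * ℓ) A →
    ∀ t ∈ Set.Icc (ℓ/3) (2*ℓ/3), γ t ∈ tubN M A

/-- Property (β₂). -/
def Beta2 (𝓐 : Set (Set X)) : Prop := ∃ ε M : ℝ, 0 < ε ∧ 0 ≤ M ∧ Beta2With 𝓐 ε M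

/-- Property (β₃) with given constants: fat geodesic hexagons lie in tubular
neighborhoods of pieces. -/
def Beta3With (𝓐 : Set (Set X)) (θ ν χ : ℝ) : Prop :=
  ∀ P : PrePolygon X 6, P.IsGeodesicPolygon → P.IsFat2 θ ν → ∃ A ∈ 𝓐, P.carrier ⊆ tubN χ A

/-- Property (β₃). -/
def Beta3 (𝓐 : Set (Set X)) : Prop :=
  ∃ θ : ℝ, 0 < θ ∧ ∃ ν : ℝ, 8 ≤ ν ∧ ∃ χ : ℝ, 0 < χ ∧ Beta3With 𝓐 θ ν χ

/-- Property (Q), uniform quasi-convexity of pieces, with given constants `t`, `K₀`. -/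
def PropQWith (𝓐 : Set (Set X)) (t K₀ : ℝ) : Prop :=
  ∀ A ∈ 𝓐, ∀ K : ℝ, K₀ ≤ K → ∀ (γ : ℝ → X) (ℓ : ℝ), IsGeodesicParam γ ℓ →
    γ 0 ∈ tubN K A → γ ℓ ∈ tubN K A → ∀ s ∈ Set.Icc (0:ℝ) ℓ, γ s ∈ tubN (t * K) A

/-- Property (Q), uniform quasi-convexity of pieces. -/
def PropQ (𝓐 : Set (Set X)) : Prop :=
  ∃ t : ℝ, 0 < t ∧ ∃ K₀ : ℝ, 0 ≤ K₀ ∧ PropQWith 𝓐 t K₀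

/-- `X` is asymptotically tree-graded with respect to `𝓐` (Druţu–Sapir metric
characterization, taken as the definition): (α₁), (α₂) and (α₃) hold. -/
def ATG (𝓐 : Set (Set X)) : Prop := Alpha1 𝓐 ∧ Alpha2 𝓐 ∧ Alpha3 𝓐

/-! ### Entrance and exit points, almost geodesics, the (*) property -/

/-- The entrance point of the path `p : [0,ℓ] → X` in the set `S`. -/
noncomputable def entrancePoint (p : ℝ → X) (ℓ : ℝ) (S : Set X) : X :=
  p (sInf {t | t ∈ Set.Icc (0:ℝ) ℓ ∧ p t ∈ S})

/-- The exit point of the path `p : [0,ℓ] → X` from the set `S`. -/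
noncomputable def exitPoint (p : ℝ → X) (ℓ : ℝ) (S : Set X) : X :=
  p (sSup {t | t ∈ Set.Icc (0:ℝ) ℓ ∧ p t ∈ S})

/-- `q` is a `(1,C)`-almost geodesic on `[0,ℓ]`: a `1`-Lipschitz `(1,C)`-quasi-geodesic. -/
def IsAlmostGeodesic (C : ℝ) (q : ℝ → X) (ℓ : ℝ) : Prop :=
  0 ≤ ℓ ∧ ∀ s ∈ Set.Icc (0:ℝ) ℓ, ∀ t ∈ Set.Icc (0:ℝ) ℓ,
    |s - t| - C ≤ dist (q s) (q t) ∧ dist (q s) (q t) ≤ |s - t|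

/-- The `(*)` alternative for triangles with `(1,C)`-almost geodesic edges,
with constants `σ`, `δ`. -/
def StarATGWith (𝓐 : Set (Set X)) (C σ δ : ℝ) : Prop :=
  ∀ T : PrePolygon X 3, T.IsClosedPolygon →
    (∀ i, IsAlmostGeodesic C (T.edge i) (T.len i)) →
    (∃ a : X, ∀ i : Fin 3, (Metric.closedBall a σ ∩ T.edgeSet i).Nonempty) ∨
    (∃ A ∈ 𝓐, (∀ i : Fin 3, (ctubN σ A ∩ T.edgeSet i).Nonempty) ∧
      ∀ i : Fin 3, dist (exitPoint (T.edge i) (T.len i) (ctubN σ A))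
        (entrancePoint (T.edge (finCycSucc i)) (T.len (finCycSucc i)) (ctubN σ A)) < δ)

/-- `X` is `(*)`-asymptotically tree-graded with respect to `𝓐`. -/
def StarATG (𝓐 : Set (Set X)) : Prop :=
  ∀ C : ℝ, 0 ≤ C → ∃ σ δ : ℝ, StarATGWith 𝓐 C σ δ

/-! ### Proof: geodesic segments as sets -/

/-- `S` is (the image of) a geodesic from `x` to `y`. -/
def IsSeg (S : Set X) (x y : X) : Prop :=
  ∃ (γ : ℝ → X) (l : ℝ), IsGeodesicParam γ l ∧ γ 0 = x ∧ γ l = y ∧ γ '' Set.Icc 0 l = S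

theorem IsSeg.left_mem {S : Set X} {x y : X} (h : IsSeg S x y) : x ∈ S := by
  obtain ⟨γ, l, hg, h0, hl, rfl⟩ := h
  exact ⟨0, ⟨le_refl _, hg.1⟩, h0⟩

theorem IsSeg.right_mem {S : Set X} {x y : X} (h : IsSeg S x y) : y ∈ S := by
  obtain ⟨γ, l, hg, h0, hl, rfl⟩ := h
  exact ⟨l, ⟨hg.1, le_refl _⟩, hl⟩

theorem IsSeg.symm {S : Set X} {x y : X} (h : IsSeg S x y) : IsSeg S y x := by
  obtain ⟨γ, l, hg, h0, hl, rfl⟩ := h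
  refine ⟨fun t => γ (l - t), l, ⟨hg.1, ?_⟩, by simpa using hl, by simpa using h0, ?_⟩
  · intro s hs t ht
    rw [hg.2 (l - s) ⟨by linarith [hs.2], by linarith [hs.1]⟩ (l - t)
      ⟨by linarith [ht.2], by linarith [ht.1]⟩, abs_sub_comm]
    congr 1; ring
  · ext p
    constructor
    · rintro ⟨t, ht, rfl⟩
      exact ⟨l - t, ⟨by linarith [ht.2], by linarith [ht.1]⟩, rfl⟩
    · rintro ⟨t, ht, rfl⟩
      exact ⟨l - t, ⟨by linarith [ht.2], by linarith [ht.1]⟩, by simp⟩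

theorem IsSeg.add {S : Set X} {x y u : X} (h : IsSeg S x y) (hu : u ∈ S) :
    dist x u + dist u y = dist x y := by
  obtain ⟨γ, l, hg, rfl, rfl, rfl⟩ := h
  obtain ⟨t, ht, rfl⟩ := hu
  have h0 : (0:ℝ) ∈ Set.Icc 0 l := ⟨le_refl _, hg.1⟩
  have hl : l ∈ Set.Icc 0 l := ⟨hg.1, le_refl _⟩
  rw [hg.2 0 h0 t ht, hg.2 t ht l hl, hg.2 0 h0 l hl, abs_of_nonpos, abs_of_nonpos, abs_of_nonpos]
  · ring
  · linarith [hg.1]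
  · linarith [ht.2]
  · linarith [ht.1]

/-- Sub-geodesic of a parametrized geodesic. -/
theorem IsGeodesicParam.sub {γ : ℝ → X} {l : ℝ} (hg : IsGeodesicParam γ l) {s t : ℝ}
    (hs : 0 ≤ s) (hst : s ≤ t) (ht : t ≤ l) : IsSeg (γ '' Set.Icc s t) (γ s) (γ t) := by
  refine ⟨fun r => γ (s + r), t - s, ⟨by linarith, ?_⟩, by simp, by simp, ?_⟩
  · intro a ha b hb
    rw [hg.2 (s + a) ⟨by linarith [ha.1], by linarith [ha.2]⟩ (s + b)
      ⟨by linarith [hb.1], by linarith [hb.2]⟩]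
    congr 1; ring
  · ext p
    constructor
    · rintro ⟨r, hr, rfl⟩
      exact ⟨s + r, ⟨by linarith [hr.1], by linarith [hr.2]⟩, rfl⟩
    · rintro ⟨r, hr, rfl⟩
      exact ⟨r - s, ⟨by linarith [hr.1], by linarith [hr.2]⟩, by simp⟩

theorem IsSeg.sub {S : Set X} {x y u v : X} (h : IsSeg S x y) (hu : u ∈ S) (hv : v ∈ S) :
    ∃ S', S' ⊆ S ∧ IsSeg S' u v := by
  obtain ⟨γ, l, hg, rfl, rfl, rfl⟩ := h
  obtain ⟨s, hs, rfl⟩ := hu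
  obtain ⟨t, ht, rfl⟩ := hv
  rcases le_total s t with hst | hst
  · exact ⟨_, Set.image_mono (Set.Icc_subset_Icc hs.1 ht.2), hg.sub hs.1 hst ht.2⟩
  · exact ⟨_, Set.image_mono (Set.Icc_subset_Icc ht.1 hs.2), (hg.sub ht.1 hst hs.2).symm⟩

theorem IsGeodesicParam.continuousOn {γ : ℝ → X} {l : ℝ} (hg : IsGeodesicParam γ l) :
    ContinuousOn γ (Set.Icc 0 l) := by
  have : LipschitzOnWith 1 γ (Set.Icc 0 l) := by
    apply LipschitzOnWith.of_dist_le_mul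
    intro a ha b hb
    rw [hg.2 a ha b hb, Real.dist_eq]
    simp
  exact this.continuousOn

theorem IsSeg.isCompact {S : Set X} {x y : X} (h : IsSeg S x y) : IsCompact S := by
  obtain ⟨γ, l, hg, rfl, rfl, rfl⟩ := h
  exact isCompact_Icc.image_of_continuousOn hg.continuousOn

/-- A nearest point on a segment. -/
theorem IsSeg.nearest {S : Set X} {x y : X} (h : IsSeg S x y) (p : X) :
    ∃ q ∈ S, dist p q = Metric.infDist p S := by
  obtain ⟨q, hq, e⟩ := h.isCompact.exists_infDist_eq_dist ⟨x, h.left_mem⟩ p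
  exact ⟨q, hq, e.symm⟩

theorem exists_seg (hX : GeodesicSpace X) (x y : X) : ∃ S, IsSeg S x y := by
  obtain ⟨γ, l, hg, h0, hl⟩ := hX x y
  exact ⟨_, γ, l, hg, h0, hl, rfl⟩

/-- Last point below a level. -/
theorem last_level {f : ℝ → ℝ} {s p κ : ℝ} (hsp : s ≤ p) (hf : ContinuousOn f (Set.Icc s p))
    (hs : f s ≤ κ) (hp : κ < f p) :
    ∃ t ∈ Set.Icc s p, f t = κ ∧ ∀ u ∈ Set.Icc t p, κ ≤ f u := by
  have hcl : IsCompact {u | u ∈ Set.Icc s p ∧ f u ≤ κ} := by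
    apply isCompact_Icc.of_isClosed_subset (s := Set.Icc s p)
    · exact hf.preimage_isClosed_of_isClosed isClosed_Icc (isClosed_Iic (a := κ))
    · exact fun u hu => hu.1
  obtain ⟨t, ⟨ht, htκ⟩, hmax⟩ := hcl.exists_isGreatest ⟨s, ⟨le_refl _, hsp⟩, hs⟩
  have key : f t = κ := by
    obtain ⟨u, hu, hfu⟩ := intermediate_value_Icc ht.2
      (hf.mono (Set.Icc_subset_Icc_left ht.1)) ⟨htκ, hp.le⟩
    have := hmax ⟨⟨ht.1.trans hu.1, hu.2⟩, hfu.le⟩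
    have : u = t := le_antisymm this hu.1
    rw [← this]; exact hfu
  refine ⟨t, ht, key, fun u hu => ?_⟩
  by_contra hlt
  push Not at hlt
  have := hmax ⟨⟨ht.1.trans hu.1, hu.2⟩, hlt.le⟩
  have : u = t := le_antisymm this hu.1
  rw [this] at hlt
  linarith

/-- First point below a level. -/
theorem first_level {f : ℝ → ℝ} {s p κ : ℝ} (hsp : s ≤ p) (hf : ContinuousOn f (Set.Icc s p))
    (hs : κ < f s) (hp : f p ≤ κ) :
    ∃ t ∈ Set.Icc s p, f t = κ ∧ ∀ u ∈ Set.Icc s t, κ ≤ f u := by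
  obtain ⟨t, ht, h1, h2⟩ := last_level (f := fun u => f (-u)) (s := -p) (p := -s) (κ := κ)
    (by linarith) (hf.comp continuous_neg.continuousOn
      (fun u hu => ⟨by linarith [hu.2], by linarith [hu.1]⟩)) (by simpa using hp) (by simpa using hs)
  refine ⟨-t, ⟨by linarith [ht.2], by linarith [ht.1]⟩, h1, fun u hu => ?_⟩
  simpa using h2 (-u) ⟨by linarith [hu.2], by linarith [hu.1]⟩

theorem IsGeodesicParam.infDist_cont {γ : ℝ → X} {l : ℝ} (hg : IsGeodesicParam γ l) (T : Set X)
    {s t : ℝ} (hs : 0 ≤ s) (ht : t ≤ l) :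
    ContinuousOn (fun r => Metric.infDist (γ r) T) (Set.Icc s t) :=
  (Metric.continuous_infDist_pt T).comp_continuousOn
    (hg.continuousOn.mono (Set.Icc_subset_Icc hs ht))

/-! ### A criterion for fatness of hexagons -/

theorem hex_bound {θ ν D : ℝ} (hθ : 0 < θ) (hν : 8 ≤ ν)
    (h : ∀ P : PrePolygon X 6, P.IsGeodesicPolygon → P.IsFat2 θ ν →
      ∀ x ∈ P.carrier, ∀ y ∈ P.carrier, dist x y ≤ D)
    (v : Fin 6 → X) (S : Fin 6 → Set X) (hS : ∀ i, IsSeg (S i) (v i) (v (i + 1)))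
    (hc : ∀ i, ∀ u ∈ S i, ∀ w ∈ S (i + 1),
      dist u (v (i + 1)) ≤ dist u w ∨ dist w (v (i + 1)) ≤ dist u w)
    (h2 : ∀ i, ∀ u ∈ S i, ∀ w ∈ S (i + 2), θ ≤ dist u w)
    (h3 : ∀ i, ∀ u ∈ S i, ∀ w ∈ S (i + 3), θ ≤ dist u w)
    (hv : ∀ i, ∀ w, w ∈ S (i + 1) ∨ w ∈ S (i + 2) ∨ w ∈ S (i + 3) ∨ w ∈ S (i + 4) →
      ν * θ ≤ dist (v i) w) (i j : Fin 6) : dist (v i) (v j) ≤ D := by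
  have hmem := fun i => (hS i).left_mem
  have hνθ : 0 < ν * θ := by positivity
  choose γ l hg h0 hl him using hS
  have hsucc : ∀ i : Fin 6, finCycSucc i = i + 1 := by decide
  have hcases : ∀ i j : Fin 6, j ≠ i →
      j = i + 1 ∨ j = i + 2 ∨ j = i + 3 ∨ i = j + 2 ∨ i = j + 1 := by decide
  have hcases' : ∀ i j : Fin 6, j ≠ i → j + 1 ≠ i →
      j = i + 1 ∨ j = i + 2 ∨ j = i + 3 ∨ j = i + 4 := by decide
  have h33 : ∀ i : Fin 6, i + 3 + 3 = i := by decide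
  have h3ne : ∀ i : Fin 6, i + 3 ≠ i ∧ i + 3 + 1 ≠ i := by decide
  let P : PrePolygon X 6 := ⟨γ, l⟩
  have hE : ∀ i, P.edgeSet i = S i := him
  have hcar : ∀ i, v i ∈ P.carrier := fun i => by
    refine Set.mem_iUnion.2 ⟨i, ?_⟩
    rw [hE]; exact hmem i
  refine h P ⟨⟨fun i => (hg i).1, fun i => ?_⟩, hg⟩ ⟨?_, ?_⟩ _ (hcar i) _ (hcar j)
  · change γ i (l i) = γ (finCycSucc i) 0
    rw [hl, hsucc, h0]
  · intro i p hp hp0 hp1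
    rw [hE] at hp ⊢
    change 2 * θ ≤ dist p (γ i 0) at hp0
    change 2 * θ ≤ dist p (γ i (l i)) at hp1
    rw [h0] at hp0
    rw [hl] at hp1
    have hne : (P.carrier \ S i).Nonempty := by
      refine ⟨v (i + 3), hcar _, fun hmem3 => ?_⟩
      have := hv (i + 3) (v (i + 3)) (Or.inr (Or.inr (Or.inl (by rw [h33]; exact hmem3))))
      rw [dist_self] at this
      linarith
    refine (Metric.le_infDist hne).2 ?_
    · rintro y ⟨hy, hyn⟩
      obtain ⟨j, hj⟩ := Set.mem_iUnion.1 hy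
      rw [hE] at hj
      have hji : j ≠ i := by rintro rfl; exact hyn hj
      rcases hcases i j hji with rfl | rfl | rfl | rfl | rfl
      · rcases hc i p hp y hj with hh | hh
        · linarith
        · linarith [dist_triangle p y (v (i + 1))]
      · exact h2 _ _ hp _ hj
      · exact h3 _ _ hp _ hj
      · rw [dist_comm]; exact h2 _ _ hj _ hp
      · rw [dist_comm p y]
        rcases hc j y hj p hp with hh | hh
        · linarith [dist_triangle p y (v (j + 1)), dist_comm p y]
        · linarith
  · intro i
    have hvi : P.vertex i = v i := h0 i
    rw [hvi]
    have hne : (P.opp i).Nonempty := by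
      refine ⟨v (i + 3), ?_⟩
      refine Set.mem_iUnion₂.2 ⟨i + 3, ⟨(h3ne i).1, ?_⟩, ?_⟩
      · rw [hsucc]; exact (h3ne i).2
      · rw [hE]; exact hmem _
    refine (Metric.le_infDist hne).2 ?_
    · intro y hy
      obtain ⟨j, ⟨hj1, hj2⟩, hyj⟩ := Set.mem_iUnion₂.1 hy
      rw [hE] at hyj
      rw [hsucc] at hj2
      apply hv i y
      rcases hcases' i j hj1 hj2 with rfl | rfl | rfl | rfl <;> tauto

/-- Hexagons with three long edges, pairwise at distance at least `κ`, joined by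
edges of length `κ`. -/
theorem hex_three {θ ν D κ : ℝ} (hθ : 0 < θ) (hν : 8 ≤ ν) (hκ : ν * θ ≤ κ)
    (h : ∀ P : PrePolygon X 6, P.IsGeodesicPolygon → P.IsFat2 θ ν →
      ∀ x ∈ P.carrier, ∀ y ∈ P.carrier, dist x y ≤ D)
    {a b b' c' c a' : X} {L0 K0 L1 K1 L2 K2 : Set X}
    (sL0 : IsSeg L0 a b) (sK0 : IsSeg K0 b b') (sL1 : IsSeg L1 b' c') (sK1 : IsSeg K1 c' c)
    (sL2 : IsSeg L2 c a') (sK2 : IsSeg K2 a' a)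
    (dK0 : dist b b' = κ) (dK1 : dist c' c = κ) (dK2 : dist a' a = κ)
    (dL0 : 3 * κ ≤ dist a b) (dL1 : 3 * κ ≤ dist b' c') (dL2 : 3 * κ ≤ dist c a')
    (f01 : ∀ u ∈ L0, ∀ w ∈ L1, κ ≤ dist u w) (f12 : ∀ u ∈ L1, ∀ w ∈ L2, κ ≤ dist u w)
    (f20 : ∀ u ∈ L2, ∀ w ∈ L0, κ ≤ dist u w) : dist a b ≤ D := by
  have h8 : 8 * θ ≤ κ := le_trans (by nlinarith) hκ
  have f10 : ∀ u ∈ L1, ∀ w ∈ L0, κ ≤ dist u w := fun u hu w hw => by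
    rw [dist_comm]; exact f01 w hw u hu
  have f21 : ∀ u ∈ L2, ∀ w ∈ L1, κ ≤ dist u w := fun u hu w hw => by
    rw [dist_comm]; exact f12 w hw u hu
  have f02 : ∀ u ∈ L0, ∀ w ∈ L2, κ ≤ dist u w := fun u hu w hw => by
    rw [dist_comm]; exact f20 w hw u hu
  -- two short edges joined by a long one
  have short : ∀ {x y z t : X} {K K' : Set X}, IsSeg K x y → IsSeg K' z t → dist x y = κ →
      dist z t = κ → 3 * κ ≤ dist y z → ∀ u ∈ K, ∀ w ∈ K', κ ≤ dist u w := by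
    intro x y z t K K' hK hK' d1 d2 d3 u hu w hw
    have := hK.add hu
    have := hK'.add hw
    have := dist_triangle4 y u w z
    rw [dist_comm y u, dist_comm w z] at this
    linarith [dist_nonneg (x := x) (y := u), dist_nonneg (x := w) (y := t)]
  -- a long edge and the opposite short edge
  have opp : ∀ {x y : X} {K L : Set X}, IsSeg K x y → dist x y = κ →
      (∀ u ∈ L, κ ≤ dist u x) → (∀ u ∈ L, κ ≤ dist u y) → ∀ u ∈ L, ∀ w ∈ K, θ ≤ dist u w := by
    intro x y K L hK d hx hy u hu w hw
    have := hK.add hw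
    have := hx u hu
    have := hy u hu
    have := dist_triangle u w x
    have := dist_triangle u w y
    rw [dist_comm w x] at *
    linarith
  -- corners
  have corner : ∀ {x y : X} {K L : Set X}, IsSeg K x y → dist x y = κ →
      (∀ u ∈ L, κ ≤ dist u y) → ∀ u ∈ L, ∀ w ∈ K, dist w x ≤ dist u w := by
    intro x y K L hK d hy u hu w hw
    have := hK.add hw
    have := hy u hu
    have := dist_triangle u w y
    rw [dist_comm w x]
    linarith
  have k01 := short sK0 sK1 dK0 dK1 dL1
  have k12 := short sK1 sK2 dK1 dK2 dL2
  have k20 := short sK2 sK0 dK2 dK0 dL0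
  have k10 : ∀ u ∈ K1, ∀ w ∈ K0, κ ≤ dist u w := fun u hu w hw => by
    rw [dist_comm]; exact k01 w hw u hu
  have k21 : ∀ u ∈ K2, ∀ w ∈ K1, κ ≤ dist u w := fun u hu w hw => by
    rw [dist_comm]; exact k12 w hw u hu
  have k02 : ∀ u ∈ K0, ∀ w ∈ K2, κ ≤ dist u w := fun u hu w hw => by
    rw [dist_comm]; exact k20 w hw u hu
  have o0 := opp sK1 dK1 (fun u hu => f01 u hu _ sL1.right_mem) (fun u hu => f02 u hu _ sL2.left_mem)
  have o1 := opp sK2 dK2 (fun u hu => f12 u hu _ sL2.right_mem) (fun u hu => f10 u hu _ sL0.left_mem)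
  have o2 := opp sK0 dK0 (fun u hu => f20 u hu _ sL0.right_mem) (fun u hu => f21 u hu _ sL1.left_mem)
  have dK0' : dist b' b = κ := by rw [dist_comm]; exact dK0
  have dK1' : dist c c' = κ := by rw [dist_comm]; exact dK1
  have dK2' : dist a a' = κ := by rw [dist_comm]; exact dK2
  have θκ : θ ≤ κ := by linarith
  refine hex_bound hθ hν h ![a, b, b', c', c, a'] ![L0, K0, L1, K1, L2, K2] ?_ ?_ ?_ ?_ ?_ 0 1
  · intro i
    fin_cases i
    exacts [sL0, sK0, sL1, sK1, sL2, sK2]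
  · intro i
    fin_cases i
    · exact fun u hu w hw => Or.inr (corner sK0 dK0 (fun u hu => f01 u hu _ sL1.left_mem) u hu w hw)
    · exact fun u hu w hw => Or.inl (by
        rw [dist_comm u w]
        exact corner sK0.symm dK0' (fun u hu => f10 u hu _ sL0.right_mem) w hw u hu)
    · exact fun u hu w hw => Or.inr (corner sK1 dK1 (fun u hu => f12 u hu _ sL2.left_mem) u hu w hw)
    · exact fun u hu w hw => Or.inl (by
        rw [dist_comm u w]
        exact corner sK1.symm dK1' (fun u hu => f21 u hu _ sL1.right_mem) w hw u hu)
    · exact fun u hu w hw => Or.inr (corner sK2 dK2 (fun u hu => f20 u hu _ sL0.left_mem) u hu w hw)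
    · exact fun u hu w hw => Or.inl (by
        rw [dist_comm u w]
        exact corner sK2.symm dK2' (fun u hu => f02 u hu _ sL2.right_mem) w hw u hu)
  · intro i u hu w hw
    refine θκ.trans ?_
    fin_cases i
    exacts [f01 u hu w hw, k01 u hu w hw, f12 u hu w hw, k12 u hu w hw, f20 u hu w hw,
      k20 u hu w hw]
  · intro i u hu w hw
    fin_cases i
    · exact o0 u hu w hw
    · rw [dist_comm]; exact o2 w hw u hu
    · exact o1 u hu w hw
    · rw [dist_comm]; exact o0 w hw u hu
    · exact o2 u hu w hw
    · rw [dist_comm]; exact o1 w hw u hu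
  · intro i w hw
    refine hκ.trans ?_
    fin_cases i
    · rcases hw with hw | hw | hw | hw
      exacts [k20 _ sK2.right_mem w hw, f01 _ sL0.left_mem w hw, k21 _ sK2.right_mem w hw,
        f02 _ sL0.left_mem w hw]
    · rcases hw with hw | hw | hw | hw
      exacts [f01 _ sL0.right_mem w hw, k01 _ sK0.left_mem w hw, f02 _ sL0.right_mem w hw,
        k02 _ sK0.left_mem w hw]
    · rcases hw with hw | hw | hw | hw
      exacts [k01 _ sK0.right_mem w hw, f12 _ sL1.left_mem w hw, k02 _ sK0.right_mem w hw,
        f10 _ sL1.left_mem w hw]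
    · rcases hw with hw | hw | hw | hw
      exacts [f12 _ sL1.right_mem w hw, k12 _ sK1.left_mem w hw, f10 _ sL1.right_mem w hw,
        k10 _ sK1.left_mem w hw]
    · rcases hw with hw | hw | hw | hw
      exacts [k12 _ sK1.right_mem w hw, f20 _ sL2.left_mem w hw, k10 _ sK1.right_mem w hw,
        f21 _ sL2.left_mem w hw]
    · rcases hw with hw | hw | hw | hw
      exacts [f20 _ sL2.right_mem w hw, k20 _ sK2.left_mem w hw, f21 _ sL2.right_mem w hw,
        k21 _ sK2.left_mem w hw]

/-- Hexagons obtained by subdividing an edge of a quadrilateral. -/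
theorem hex_quad {θ ν D κ : ℝ} (hθ : 0 < θ) (hν : 8 ≤ ν) (hκ : ν * θ ≤ κ)
    (h : ∀ P : PrePolygon X 6, P.IsGeodesicPolygon → P.IsFat2 θ ν →
      ∀ x ∈ P.carrier, ∀ y ∈ P.carrier, dist x y ≤ D)
    {γ : ℝ → X} {l s m : ℝ} (hg : IsGeodesicParam γ l) (hs : 0 ≤ s) (hm : 2 * κ ≤ m)
    (ht : s + m + m + m ≤ l) {a' b' : X} {K T K' : Set X}
    (sK : IsSeg K (γ (s + m + m + m)) b') (sT : IsSeg T b' a') (sK' : IsSeg K' a' (γ s))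
    (dK : dist (γ (s + m + m + m)) b' = κ) (dK' : dist a' (γ s) = κ)
    (far : ∀ r, s ≤ r → r ≤ s + m + m + m → ∀ w ∈ T, κ ≤ dist (γ r) w) : 3 * m ≤ D := by
  have h8 : 8 * θ ≤ κ := le_trans (by nlinarith) hκ
  have hm0 : 0 ≤ m := by linarith
  have hle : ∀ r r', s ≤ r → r ≤ r' → r' ≤ s + m + m + m → dist (γ r) (γ r') = r' - r := by
    intro r r' h1 h2 h3
    rw [hg.2 r ⟨by linarith, by linarith⟩ r' ⟨by linarith, by linarith⟩, abs_of_nonpos] <;> linarith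
  set t := s + m + m + m with htdef
  have s0 := hg.sub (s := s) (t := s + m) hs (by linarith) (by linarith)
  have s1 := hg.sub (s := s + m) (t := s + m + m) (by linarith) (by linarith) (by linarith)
  have s2 := hg.sub (s := s + m + m) (t := t) (by linarith) (by linarith) (by linarith)
  -- distance from points of the long edge to the short edges
  have nK : ∀ r, s ≤ r → r ≤ t → ∀ w ∈ K, t - r - κ ≤ dist (γ r) w := by
    intro r h1 h2 w hw
    have e1 := hle r t h1 h2 le_rfl
    have e2 := sK.add hw
    have e3 := dist_triangle (γ r) w (γ t)
    rw [dist_comm w] at e3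
    linarith [dist_nonneg (x := w) (y := b')]
  have nK' : ∀ r, s ≤ r → r ≤ t → ∀ w ∈ K', r - s - κ ≤ dist (γ r) w := by
    intro r h1 h2 w hw
    have e1 := hle s r le_rfl h1 h2
    have e2 := sK'.add hw
    have e3 := dist_triangle (γ r) w (γ s)
    rw [dist_comm (γ r) (γ s)] at e3
    linarith [dist_nonneg (x := a') (y := w)]
  have nKK : ∀ u ∈ K, ∀ w ∈ K', κ ≤ dist u w := by
    intro u hu w hw
    have e1 := nK' t (by linarith) le_rfl w hw
    have e2 := sK.add hu
    have e3 := dist_triangle (γ t) u w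
    linarith [dist_nonneg (x := u) (y := b')]
  have nKK' : ∀ u ∈ K', ∀ w ∈ K, κ ≤ dist u w := fun u hu w hw => by
    rw [dist_comm]; exact nKK w hw u hu
  have corner : ∀ {x y : X} {K L : Set X}, IsSeg K x y → dist x y = κ →
      (∀ u ∈ L, κ ≤ dist u y) → ∀ u ∈ L, ∀ w ∈ K, dist w x ≤ dist u w := by
    intro x y K L hK d hy u hu w hw
    have := hK.add hw
    have := hy u hu
    have := dist_triangle u w y
    rw [dist_comm w x]
    linarith
  have dK2 : dist b' (γ t) = κ := by rw [dist_comm]; exact dK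
  have dK2' : dist (γ s) a' = κ := by rw [dist_comm]; exact dK'
  have far' : ∀ r, s ≤ r → r ≤ t → ∀ w ∈ T, κ ≤ dist w (γ r) := fun r h1 h2 w hw => by
    rw [dist_comm]; exact far r h1 h2 w hw
  have hd := hex_bound hθ hν h ![γ s, γ (s + m), γ (s + m + m), γ t, b', a']
    ![γ '' Set.Icc s (s + m), γ '' Set.Icc (s + m) (s + m + m), γ '' Set.Icc (s + m + m) t,
      K, T, K'] ?_ ?_ ?_ ?_ ?_ 0 3
  · have e : dist (γ s) (γ t) ≤ D := hd
    rw [hle s t le_rfl (by linarith) le_rfl] at e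
    linarith
  · intro i
    fin_cases i
    exacts [s0, s1, s2, sK, sT, sK']
  · intro i
    fin_cases i
    · rintro _ ⟨r, hr, rfl⟩ _ ⟨r', hr', rfl⟩
      left
      change dist (γ r) (γ (s + m)) ≤ _
      rw [hle r (s + m) hr.1 hr.2 (by linarith),
        hle r r' hr.1 (hr.2.trans hr'.1) (by linarith [hr'.2])]
      linarith [hr'.1]
    · rintro _ ⟨r, hr, rfl⟩ _ ⟨r', hr', rfl⟩
      left
      change dist (γ r) (γ (s + m + m)) ≤ _
      rw [hle r (s + m + m) (by linarith [hr.1]) hr.2 (by linarith),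
        hle r r' (by linarith [hr.1]) (hr.2.trans hr'.1) hr'.2]
      linarith [hr'.1]
    · intro u hu w hw
      refine Or.inr (corner sK dK ?_ u hu w hw)
      rintro _ ⟨r, hr, rfl⟩
      exact far r (by linarith [hr.1]) hr.2 _ sT.left_mem
    · intro u hu w hw
      left
      rw [dist_comm u w]
      exact corner sK.symm dK2 (fun w hw => far' t (by linarith) le_rfl w hw) w hw u hu
    · intro u hu w hw
      exact Or.inr (corner sK' dK' (fun w hw => far' s le_rfl (by linarith) w hw) u hu w hw)
    · intro u hu w hw
      left
      rw [dist_comm u w]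
      refine corner sK'.symm dK2' ?_ w hw u hu
      rintro _ ⟨r, hr, rfl⟩
      exact far r hr.1 (by linarith [hr.2]) _ sT.right_mem
  · intro i
    fin_cases i
    · rintro _ ⟨r, hr, rfl⟩ _ ⟨r', hr', rfl⟩
      rw [hle r r' hr.1 (by linarith [hr.2, hr'.1]) hr'.2]
      linarith [hr.2, hr'.1]
    · rintro _ ⟨r, hr, rfl⟩ w hw
      linarith [nK r (by linarith [hr.1]) (by linarith [hr.2]) w hw, hr.2]
    · rintro _ ⟨r, hr, rfl⟩ w hw
      linarith [far r (by linarith [hr.1]) hr.2 w hw]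
    · intro u hu w hw
      linarith [nKK u hu w hw]
    · rintro u hu _ ⟨r, hr, rfl⟩
      linarith [far' r hr.1 (by linarith [hr.2]) u hu]
    · rintro u hu _ ⟨r, hr, rfl⟩
      rw [dist_comm]
      linarith [nK' r (by linarith [hr.1]) (by linarith [hr.2]) u hu, hr.1]
  · intro i
    fin_cases i
    · rintro _ ⟨r, hr, rfl⟩ w hw
      linarith [nK r hr.1 (by linarith [hr.2]) w hw, hr.2]
    · rintro _ ⟨r, hr, rfl⟩ w hw
      linarith [far r (by linarith [hr.1]) (by linarith [hr.2]) w hw]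
    · rintro _ ⟨r, hr, rfl⟩ w hw
      linarith [nK' r (by linarith [hr.1]) hr.2 w hw, hr.1]
    · rintro u hu _ ⟨r, hr, rfl⟩
      rw [dist_comm]
      linarith [nK r hr.1 (by linarith [hr.2]) u hu, hr.2]
    · rintro u hu _ ⟨r, hr, rfl⟩
      linarith [far' r (by linarith [hr.1]) (by linarith [hr.2]) u hu]
    · rintro u hu _ ⟨r, hr, rfl⟩
      rw [dist_comm]
      linarith [nK' r (by linarith [hr.1]) hr.2 u hu, hr.1]
  · intro i w hw
    refine hκ.trans ?_
    fin_cases i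
    · change κ ≤ dist (γ s) w
      rcases hw with ⟨r, hr, rfl⟩ | ⟨r, hr, rfl⟩ | hw | hw
      · rw [hle s r le_rfl (by linarith [hr.1]) (by linarith [hr.2])]
        linarith [hr.1]
      · rw [hle s r le_rfl (by linarith [hr.1]) (by linarith [hr.2])]
        linarith [hr.1]
      · linarith [nK s le_rfl (by linarith) w hw]
      · exact far s le_rfl (by linarith) w hw
    · change κ ≤ dist (γ (s + m)) w
      rcases hw with ⟨r, hr, rfl⟩ | hw | hw | hw
      · rw [hle (s + m) r (by linarith) (by linarith [hr.1]) (by linarith [hr.2])]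
        linarith [hr.1]
      · linarith [nK (s + m) (by linarith) (by linarith) w hw]
      · exact far _ (by linarith) (by linarith) w hw
      · linarith [nK' (s + m) (by linarith) (by linarith) w hw]
    · change κ ≤ dist (γ (s + m + m)) w
      rcases hw with hw | hw | hw | ⟨r, hr, rfl⟩
      · linarith [nK (s + m + m) (by linarith) (by linarith) w hw]
      · exact far _ (by linarith) (by linarith) w hw
      · linarith [nK' (s + m + m) (by linarith) (by linarith) w hw]
      · rw [dist_comm, hle r (s + m + m) hr.1 (by linarith [hr.2]) (by linarith)]
        linarith [hr.2]
    · change κ ≤ dist (γ t) w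
      rcases hw with hw | hw | ⟨r, hr, rfl⟩ | ⟨r, hr, rfl⟩
      · exact far t (by linarith) le_rfl w hw
      · linarith [nK' t (by linarith) le_rfl w hw]
      · rw [dist_comm, hle r t hr.1 (by linarith [hr.2]) le_rfl]
        linarith [hr.2]
      · rw [dist_comm, hle r t (by linarith [hr.1]) (by linarith [hr.2]) le_rfl]
        linarith [hr.2]
    · change κ ≤ dist b' w
      rcases hw with hw | ⟨r, hr, rfl⟩ | ⟨r, hr, rfl⟩ | ⟨r, hr, rfl⟩
      · exact nKK _ sK.right_mem w hw
      · exact far' r hr.1 (by linarith [hr.2]) _ sT.left_mem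
      · exact far' r (by linarith [hr.1]) (by linarith [hr.2]) _ sT.left_mem
      · exact far' r (by linarith [hr.1]) (by linarith [hr.2]) _ sT.left_mem
    · change κ ≤ dist a' w
      rcases hw with ⟨r, hr, rfl⟩ | ⟨r, hr, rfl⟩ | ⟨r, hr, rfl⟩ | hw
      · exact far' r hr.1 (by linarith [hr.2]) _ sT.right_mem
      · exact far' r (by linarith [hr.1]) (by linarith [hr.2]) _ sT.right_mem
      · exact far' r (by linarith [hr.1]) (by linarith [hr.2]) _ sT.right_mem
      · exact nKK' _ sK'.left_mem w hw

/-- Quasi-convexity: a geodesic that is `κ`-close to `T` before and after a time is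
close to `T` at this time. -/
theorem quasi_convex (hX : GeodesicSpace X) {θ ν D κ : ℝ} (hθ : 0 < θ) (hν : 8 ≤ ν)
    (hκ : ν * θ ≤ κ)
    (h : ∀ P : PrePolygon X 6, P.IsGeodesicPolygon → P.IsFat2 θ ν →
      ∀ x ∈ P.carrier, ∀ y ∈ P.carrier, dist x y ≤ D)
    {γ : ℝ → X} {l : ℝ} (hg : IsGeodesicParam γ l) {T : Set X} {x y : X} (hT : IsSeg T x y)
    {r p r' : ℝ} (h0 : 0 ≤ r) (h1 : r ≤ p) (h2 : p ≤ r') (h3 : r' ≤ l)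
    (hr : Metric.infDist (γ r) T ≤ κ) (hr' : Metric.infDist (γ r') T ≤ κ) :
    Metric.infDist (γ p) T ≤ 4 * κ + |D| := by
  by_contra hcon
  push Not at hcon
  have hκ0 : 0 < κ := lt_of_lt_of_le (by positivity) hκ
  have hD := abs_nonneg D
  obtain ⟨s, hs, es, fs⟩ := last_level h1 (hg.infDist_cont T h0 (h2.trans h3)) hr (by linarith)
  obtain ⟨t, ht, et, ft⟩ := first_level h2 (hg.infDist_cont T (h0.trans h1) h3) (by linarith) hr'
  have lip : ∀ u v, 0 ≤ u → u ≤ v → v ≤ l → |Metric.infDist (γ u) T - Metric.infDist (γ v) T| ≤ v - u := by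
    intro u v hu huv hv
    have e : dist (γ u) (γ v) = v - u := by
      rw [hg.2 u ⟨hu, by linarith⟩ v ⟨by linarith, hv⟩, abs_of_nonpos] <;> linarith
    rw [abs_le]
    constructor
    · linarith [Metric.infDist_le_infDist_add_dist (s := T) (x := γ v) (y := γ u), dist_comm (γ u) (γ v)]
    · linarith [Metric.infDist_le_infDist_add_dist (s := T) (x := γ u) (y := γ v)]
  have l1 := abs_le.1 (lip s p (by linarith [hs.1]) hs.2 (by linarith))
  have l2 := abs_le.1 (lip p t (by linarith) ht.1 (by linarith [ht.2]))
  obtain ⟨a', ha', ea⟩ := hT.nearest (γ s)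
  obtain ⟨b', hb', eb⟩ := hT.nearest (γ t)
  obtain ⟨T', hTT, sT⟩ := hT.sub hb' ha'
  obtain ⟨K, sK⟩ := exists_seg hX (γ t) b'
  obtain ⟨K', sK'⟩ := exists_seg hX a' (γ s)
  have htm : s + (t - s) / 3 + (t - s) / 3 + (t - s) / 3 = t := by ring
  have := hex_quad (s := s) (m := (t - s) / 3) hθ hν hκ h hg (by linarith [hs.1]) (by linarith)
    (by linarith [ht.2]) (by rw [htm]; exact sK) sT sK' (by rw [htm]; linarith)
    (by rw [dist_comm]; linarith) (by
      rw [htm]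
      intro q hq1 hq2 w hw
      have : κ ≤ Metric.infDist (γ q) T := by
        rcases le_total q p with hqp | hqp
        · exact fs q ⟨hq1, hqp⟩
        · exact ft q ⟨hqp, hq2⟩
      exact this.trans (Metric.infDist_le_dist_of_mem (hTT hw)))
  linarith [le_abs_self D]

theorem thin_side (hX : GeodesicSpace X) {θ ν D κ : ℝ} (hθ : 0 < θ) (hν : 8 ≤ ν)
    (hκ : ν * θ ≤ κ)
    (h : ∀ P : PrePolygon X 6, P.IsGeodesicPolygon → P.IsFat2 θ ν →
      ∀ x ∈ P.carrier, ∀ y ∈ P.carrier, dist x y ≤ D)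
    {S T1 T2 : Set X} {x y z : X} (hS : IsSeg S x y) (hT1 : IsSeg T1 x z) (hT2 : IsSeg T2 y z)
    {p : X} (hp : p ∈ S) : Metric.infDist p (T2 ∪ T1) ≤ 20 * κ + |D| := by
  by_contra hcon
  push Not at hcon
  have hκ0 : 0 < κ := lt_of_lt_of_le (by positivity) hκ
  have hD := abs_nonneg D
  obtain ⟨γ, l, hg, rfl, rfl, rfl⟩ := hS
  obtain ⟨t0, ht0, rfl⟩ := hp
  have p1 : 20 * κ + |D| < Metric.infDist (γ t0) T1 :=
    hcon.trans_le (Metric.infDist_le_infDist_of_subset Set.subset_union_right ⟨_, hT1.left_mem⟩)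
  have p2 : 20 * κ + |D| < Metric.infDist (γ t0) T2 :=
    hcon.trans_le (Metric.infDist_le_infDist_of_subset Set.subset_union_left ⟨_, hT2.left_mem⟩)
  have z1 : Metric.infDist (γ 0) T1 = 0 := Metric.infDist_zero_of_mem hT1.left_mem
  have z2 : Metric.infDist (γ l) T2 = 0 := Metric.infDist_zero_of_mem hT2.left_mem
  -- quasi-convexity with the constant `5κ`
  have q1 : ∀ u, t0 ≤ u → u ≤ l → 5 * κ < Metric.infDist (γ u) T1 := by
    intro u hu hul
    by_contra hh
    push Not at hh
    have := quasi_convex hX hθ hν (κ := 5 * κ) (by linarith) h hg hT1 le_rfl ht0.1 hu hul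
      (by linarith) hh
    linarith
  have q2 : ∀ u, 0 ≤ u → u ≤ t0 → 5 * κ < Metric.infDist (γ u) T2 := by
    intro u hu hul
    by_contra hh
    push Not at hh
    have := quasi_convex hX hθ hν (κ := 5 * κ) (by linarith) h hg hT2 hu hul ht0.2 le_rfl
      hh (by linarith)
    linarith
  obtain ⟨s, hs, es, fs⟩ := last_level (κ := κ) ht0.1 (hg.infDist_cont T1 le_rfl ht0.2)
    (by linarith) (by linarith)
  obtain ⟨t, ht, et, ft⟩ := first_level (κ := κ) ht0.2 (hg.infDist_cont T2 ht0.1 le_rfl)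
    (by linarith) (by linarith)
  have far1 : ∀ r, s ≤ r → r ≤ t → κ ≤ Metric.infDist (γ r) T1 := by
    intro r h1 h2
    rcases le_total r t0 with hr | hr
    · exact fs r ⟨h1, hr⟩
    · linarith [q1 r hr (by linarith [ht.2])]
  have far2 : ∀ r, s ≤ r → r ≤ t → κ ≤ Metric.infDist (γ r) T2 := by
    intro r h1 h2
    rcases le_total r t0 with hr | hr
    · linarith [q2 r (by linarith [hs.1]) hr]
    · exact ft r ⟨hr, h2⟩
  obtain ⟨a', ha', ea⟩ := hT1.nearest (γ s)
  obtain ⟨b', hb', eb⟩ := hT2.nearest (γ t)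
  obtain ⟨U1, hU1, sU1⟩ := hT1.sub ha' hT1.right_mem
  obtain ⟨U2, hU2, sU2⟩ := hT2.sub hb' hT2.right_mem
  have sU1' := sU1
  obtain ⟨η, m, hη, η0, ηm, ηi⟩ := sU1'
  have η1 : ∀ r, 0 ≤ r → r ≤ m → η r ∈ U1 := fun r h1 h2 => by
    rw [← ηi]; exact ⟨r, ⟨h1, h2⟩, rfl⟩
  -- a point of `U1` close to `U2` is far from `a'`
  have Ra : ∀ c ∈ U1, Metric.infDist c U2 ≤ κ → 3 * κ < dist c a' := by
    intro c hc hcU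
    by_contra hh
    push Not at hh
    have e1 := q2 s hs.1 hs.2
    have e2 : Metric.infDist c T2 ≤ κ :=
      (Metric.infDist_le_infDist_of_subset hU2 ⟨_, sU2.left_mem⟩).trans hcU
    have e3 := Metric.infDist_le_infDist_add_dist (s := T2) (x := γ s) (y := c)
    have e4 := dist_triangle (γ s) a' c
    rw [dist_comm a' c] at e4
    linarith
  have Rb : ∀ c ∈ U1, ∀ c' ∈ U2, dist c c' ≤ κ → 3 * κ < dist b' c' := by
    intro c hc c' hc' hd
    by_contra hh
    push Not at hh
    have e1 := q1 t ht.1 ht.2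
    have e2 := Metric.infDist_le_dist_of_mem (x := γ t) (hU1 hc)
    have e4 := dist_triangle4 (γ t) b' c' c
    rw [dist_comm c' c] at e4
    linarith
  have g0 : κ < Metric.infDist (η 0) U2 := by
    by_contra hh
    push Not at hh
    have := Ra (η 0) (η1 0 le_rfl hη.1) hh
    rw [η0, dist_self] at this
    linarith
  have gm : Metric.infDist (η m) U2 ≤ κ := by
    rw [ηm, Metric.infDist_zero_of_mem sU2.right_mem]; exact hκ0.le
  obtain ⟨q, hq, eq, fq⟩ := first_level hη.1 (hη.infDist_cont U2 le_rfl le_rfl) g0 gm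
  clear gm
  obtain ⟨c', hc', ec⟩ := sU2.nearest (η q)
  have sL2 := (hη.sub le_rfl hq.1 hq.2).symm
  rw [η0] at sL2
  obtain ⟨L1, hL1, sL1⟩ := sU2.sub sU2.left_mem hc'
  obtain ⟨K0, sK0⟩ := exists_seg hX (γ t) b'
  obtain ⟨K1, sK1⟩ := exists_seg hX c' (η q)
  obtain ⟨K2, sK2⟩ := exists_seg hX a' (γ s)
  have sL0 := hg.sub hs.1 (hs.2.trans ht.1) ht.2
  have lab : 2 * (19 * κ + |D|) ≤ dist (γ s) (γ t) := by
    have e : dist (γ s) (γ t) = dist (γ s) (γ t0) + dist (γ t0) (γ t) :=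
      (sL0.add ⟨t0, ⟨hs.2, ht.1⟩, rfl⟩).symm
    have e1 := Metric.infDist_le_infDist_add_dist (s := T1) (x := γ t0) (y := γ s)
    have e2 := Metric.infDist_le_infDist_add_dist (s := T2) (x := γ t0) (y := γ t)
    rw [dist_comm (γ t0) (γ s)] at e1
    linarith
  have := hex_three hθ hν hκ h sL0 sK0 sL1 sK1 sL2 sK2 (by linarith) (by rw [dist_comm]; linarith)
    (by rw [dist_comm]; linarith) (by linarith)
    (Rb _ (η1 q hq.1 hq.2) _ hc' (by linarith)).le (Ra _ (η1 q hq.1 hq.2) eq.le).le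
    (by
      rintro _ ⟨r, hr, rfl⟩ w hw
      exact (far2 r hr.1 hr.2).trans (Metric.infDist_le_dist_of_mem (hU2 (hL1 hw))))
    (by
      rintro w hw _ ⟨r, hr, rfl⟩
      rw [dist_comm]
      exact (fq r hr).trans (Metric.infDist_le_dist_of_mem (hL1 hw)))
    (by
      rintro _ ⟨r, hr, rfl⟩ _ ⟨r', hr', rfl⟩
      rw [dist_comm]
      exact (far1 r' hr'.1 hr'.2).trans
        (Metric.infDist_le_dist_of_mem (hU1 (η1 r hr.1 (hr.2.trans hq.2)))))
  linarith [le_abs_self D]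

/-- **Corollary.** If in a geodesic metric space `X`, for some `θ > 0` and `ν ≥ 8`, the
set of `(θ,ν)`-fat geodesic hexagons is empty or consists of hexagons of uniformly
bounded diameter, then `X` is Gromov hyperbolic. -/
theorem hyperbolic_of_bounded_fat_hexagons (hX : GeodesicSpace X)
    (θ ν : ℝ) (hθ : 0 < θ) (hν : 8 ≤ ν)
    (h : ∃ D : ℝ, ∀ P : PrePolygon X 6, P.IsGeodesicPolygon → P.IsFat2 θ ν →
      ∀ x ∈ P.carrier, ∀ y ∈ P.carrier, dist x y ≤ D) :
    GromovHyperbolic X := by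
  obtain ⟨D, h⟩ := h
  refine ⟨20 * (ν * θ) + |D|, by positivity, fun T hT i p hp => ?_⟩
  have hseg : ∀ i, IsSeg (T.edgeSet i) (T.edge i 0) (T.edge (finCycSucc i) 0) :=
    fun i => ⟨T.edge i, T.len i, hT.2 i, rfl, hT.1.2 i, rfl⟩
  have h3 : ∀ i : Fin 3, finCycSucc (finCycSucc (finCycSucc i)) = i := by decide
  have h1 := hseg (finCycSucc (finCycSucc i))
  rw [h3] at h1
  exact thin_side hX hθ hν le_rfl h (hseg i) h1.symm (hseg (finCycSucc i)) hp
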